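/- arXiv:math/0404418 — 3 statements merged into one kernel-verified Lean document; each statement's English description precedes it below -/
import Mathlib

section
/- The derivative of ξ satisfies ξ'(t) < 0 for t in (−π/2, 0), ξ'(0) = 0, and ξ'(t) > 0 for t in (0, π/2). -/
open Real Set Filter Topology

noncomputable def xi (t : ℝ) : ℝ :=
  (Real.cos t ^ 2 + 2 * t * Real.sin t * Real.cos t + t ^ 2 - Real.pi ^ 2 / 4) / Real.cos t ^ 2

noncomputable def eta (t : ℝ) : ℝ :=
  ((4 / Real.pi) * t + (4 / Real.pi) * Real.cos t * Real.sin t - 2 * Real.sin t) / Real.cos t ^ 2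

theorem hasDerivAt_xi {t : ℝ} (hc : Real.cos t ≠ 0) :
    HasDerivAt xi
      (2 * (Real.sin t * (Real.cos t ^ 2 + t ^ 2 - Real.pi ^ 2 / 4) + 2 * t * Real.cos t) /
        Real.cos t ^ 3) t := by
  have hs := Real.hasDerivAt_sin t
  have hc' := Real.hasDerivAt_cos t
  have ht := hasDerivAt_id' t
  have h := ((((hc'.pow 2).add (((ht.const_mul 2).mul hs).mul hc')).add (ht.pow 2)).sub_const
    (Real.pi ^ 2 / 4)).div (hc'.pow 2) (pow_ne_zero 2 hc)
  refine h.congr_deriv ?_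
  simp only [Pi.add_apply, Pi.mul_apply, Pi.pow_apply]
  field_simp
  have := Real.sin_sq t
  push_cast
  ring_nf
  simp only [this]
  ring

/-- The function `cos² t + t² - π² / 4 + 2 t cot t` decreases to `0` at `π / 2`. -/
theorem cos_sq_add_sq_add_mul_cot_pos {t : ℝ} (ht : t ∈ Set.Ioo (0 : ℝ) (Real.pi / 2)) :
    0 < Real.cos t ^ 2 + t ^ 2 - Real.pi ^ 2 / 4 + 2 * t * Real.cos t / Real.sin t := by
  set H : ℝ → ℝ := fun x =>
    Real.cos x ^ 2 + x ^ 2 - Real.pi ^ 2 / 4 + 2 * x * Real.cos x / Real.sin x with hH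
  have sin_pos : ∀ x ∈ Set.Ioc (0 : ℝ) (Real.pi / 2), 0 < Real.sin x := fun x hx =>
    Real.sin_pos_of_pos_of_lt_pi hx.1 (by linarith [hx.2, Real.pi_pos])
  have hderiv : ∀ x ∈ Set.Ioc (0 : ℝ) (Real.pi / 2),
      HasDerivAt H (2 * Real.cos x ^ 2 / Real.sin x ^ 2 * (Real.sin x * Real.cos x - x)) x := by
    intro x hx
    have hs0 := (sin_pos x hx).ne'
    have hs := Real.hasDerivAt_sin x
    have hc := Real.hasDerivAt_cos x
    have hx' := hasDerivAt_id' x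
    have h := (((hc.pow 2).add (hx'.pow 2)).sub_const (Real.pi ^ 2 / 4)).add
      (((hx'.const_mul 2).mul hc).div hs hs0)
    refine h.congr_deriv ?_
    simp only [Pi.mul_apply]
    field_simp
    have := Real.cos_sq' x
    have h3 : Real.cos x ^ 3 = Real.cos x * (1 - Real.sin x ^ 2) := by rw [← this]; ring
    push_cast
    ring_nf
    simp only [this, h3]
    ring
  have hanti : StrictAntiOn H (Set.Ioc 0 (Real.pi / 2)) := by
    refine strictAntiOn_of_deriv_neg (convex_Ioc _ _)
      (fun x hx => (hderiv x hx).continuousAt.continuousWithinAt) fun x hx => ?_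
    rw [interior_Ioc] at hx
    have hx' := Set.Ioo_subset_Ioc_self hx
    rw [(hderiv x hx').deriv]
    have hs := sin_pos x hx'
    have hc : 0 < Real.cos x := Real.cos_pos_of_mem_Ioo ⟨by linarith [hx.1, Real.pi_pos], hx.2⟩
    have hsc : Real.sin x * Real.cos x - x < 0 := by
      nlinarith [Real.sin_lt hx.1, Real.cos_le_one x]
    exact mul_neg_of_pos_of_neg (by positivity) hsc
  have hlt := hanti (Set.Ioo_subset_Ioc_self ht) (Set.right_mem_Ioc.2 (ht.1.trans ht.2)) ht.2
  have hend : H (Real.pi / 2) = 0 := by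
    simp only [hH, Real.cos_pi_div_two]
    ring
  rwa [hend] at hlt

theorem deriv_xi_pos {t : ℝ} (ht : t ∈ Set.Ioo (0 : ℝ) (Real.pi / 2)) : 0 < deriv xi t := by
  have hc : 0 < Real.cos t := Real.cos_pos_of_mem_Ioo ⟨by linarith [ht.1, Real.pi_pos], ht.2⟩
  have hs : 0 < Real.sin t :=
    Real.sin_pos_of_pos_of_lt_pi ht.1 (by linarith [ht.2, Real.pi_pos])
  rw [(hasDerivAt_xi hc.ne').deriv]
  have h := mul_pos hs (cos_sq_add_sq_add_mul_cot_pos ht)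
  rw [mul_add, mul_div_cancel₀ _ hs.ne'] at h
  positivity

theorem deriv_xi_neg (t : ℝ) : deriv xi (-t) = -deriv xi t := by
  have heven : (fun x => xi (-x)) = xi := by
    funext x
    simp [xi]
  have h := deriv_comp_neg xi t
  rw [heven] at h
  rw [h, neg_neg]

theorem xi_deriv_sign :
    (∀ t ∈ Set.Ioo (-(Real.pi / 2)) (0 : ℝ), deriv xi t < 0) ∧
    deriv xi 0 = 0 ∧
    (∀ t ∈ Set.Ioo (0 : ℝ) (Real.pi / 2), 0 < deriv xi t) := by
  refine ⟨fun t ht => ?_, ?_, fun t ht => deriv_xi_pos ht⟩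
  · have h := deriv_xi_pos (t := -t) ⟨by linarith [ht.2], by linarith [ht.1]⟩
    rw [deriv_xi_neg] at h
    linarith
  · have h := deriv_xi_neg 0
    rw [neg_zero] at h
    linarith
end

section
/- The second derivative of η satisfies −1/2 ≤ η''(t) ≤ 1/2 for all t in (−π/2, π/2); moreover η''(t) tends to −1/2 as t tends to −π/2 from the right and tends to 1/2 as t tends to π/2 from the left, and η'' is strictly increasing on (−π/2, π/2). -/
open Real Set Filter Topology

/-- The numerator of `eta`. -/
noncomputable def etaNum (t : ℝ) : ℝ :=
  (4 / π) * t + (4 / π) * cos t * sin t - 2 * sin t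

/-- The closed form of the second derivative of `eta`. -/
noncomputable def etaSecond (t : ℝ) : ℝ :=
  (-6 * sin t * cos t ^ 2 + (16 / π) * sin t * cos t ^ 3 + (6 - 4 * cos t ^ 2) * etaNum t) /
    cos t ^ 4

theorem etaNum_pi_div_two : etaNum (π / 2) = 0 := by
  have := pi_ne_zero
  simp only [etaNum, cos_pi_div_two, sin_pi_div_two]
  field_simp
  ring

theorem etaNum_neg (t : ℝ) : etaNum (-t) = -etaNum t := by
  simp only [etaNum, cos_neg, sin_neg]
  ring

theorem etaSecond_neg (t : ℝ) : etaSecond (-t) = -etaSecond t := by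
  simp only [etaSecond, etaNum_neg, cos_neg, sin_neg]
  ring

theorem hasDerivAt_etaNum (t : ℝ) :
    HasDerivAt etaNum ((8 / π) * cos t ^ 2 - 2 * cos t) t := by
  have h := (((hasDerivAt_id t).const_mul (4 / π)).add
    (((hasDerivAt_cos t).const_mul (4 / π)).mul (hasDerivAt_sin t))).sub
    ((hasDerivAt_sin t).const_mul 2)
  refine h.congr_deriv ?_
  linear_combination (-(4 / π)) * sin_sq_add_cos_sq t

theorem hasDerivAt_eta {t : ℝ} (hc : cos t ≠ 0) :
    HasDerivAt eta (8 / π - 2 / cos t + 2 * sin t * etaNum t / cos t ^ 3) t := by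
  have h := (hasDerivAt_etaNum t).div ((hasDerivAt_cos t).pow 2) (pow_ne_zero 2 hc)
  refine HasDerivAt.congr_deriv (f := eta) h ?_
  have := pi_ne_zero
  simp only [Pi.pow_apply]
  field_simp
  ring

theorem hasDerivAt_deriv_eta {t : ℝ} (hc : cos t ≠ 0) :
    HasDerivAt (deriv eta) (etaSecond t) t := by
  have h := ((hasDerivAt_const t (8 / π)).sub
    ((hasDerivAt_const t (2 : ℝ)).div (hasDerivAt_cos t) hc)).add
    ((((hasDerivAt_sin t).const_mul 2).mul (hasDerivAt_etaNum t)).div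
      ((hasDerivAt_cos t).pow 3) (pow_ne_zero 3 hc))
  have hev : ∀ᶠ x in 𝓝 t, cos x ≠ 0 := continuous_cos.continuousAt.eventually_ne hc
  refine (h.congr_of_eventuallyEq ?_).congr_deriv ?_
  · filter_upwards [hev] with x hx using (hasDerivAt_eta hx).deriv
  · have := pi_ne_zero
    have hs := sin_sq t
    simp only [etaSecond, Pi.pow_apply, Pi.mul_apply]
    field_simp
    grind

theorem hasDerivAt_etaSecond {t : ℝ} (hc : cos t ≠ 0) :
    HasDerivAt etaSecond ((8 * sin t * (3 - cos t ^ 2) * etaNum t + 14 * cos t ^ 4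
      - 24 * cos t ^ 2 + (64 * cos t ^ 3 - 32 * cos t ^ 5) / π) / cos t ^ 5) t := by
  have h := (((((hasDerivAt_sin t).const_mul (-6)).mul ((hasDerivAt_cos t).pow 2)).add
    (((hasDerivAt_sin t).const_mul (16 / π)).mul ((hasDerivAt_cos t).pow 3))).add
    ((((hasDerivAt_cos t).pow 2).const_mul 4).const_sub 6 |>.mul (hasDerivAt_etaNum t))).div
    ((hasDerivAt_cos t).pow 4) (pow_ne_zero 4 hc)
  refine HasDerivAt.congr_deriv (f := etaSecond) h ?_
  have := pi_ne_zero
  have hs := sin_sq t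
  simp only [Pi.pow_apply, Pi.mul_apply, Pi.add_apply]
  field_simp
  grind

theorem pi_mul_cubic_lt {c : ℝ} (h0 : 0 < c) (h1 : c ≤ 1) :
    π * (c * (9 + c ^ 2)) < 16 * (1 + c ^ 2) := by
  have hp := pi_lt_d2
  have : 0 < c * (9 + c ^ 2) := by positivity
  nlinarith [mul_lt_mul_of_pos_right hp this, mul_nonneg (sub_nonneg.2 h1) (sq_nonneg (c - 1)),
    mul_nonneg (sub_nonneg.2 h1) (sq_nonneg c), mul_nonneg (sub_nonneg.2 h1) h0.le]

/-- The quotient of the third derivative of `eta` by its coefficient of `etaNum`. -/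
noncomputable def etaThirdQuot (t : ℝ) : ℝ :=
  etaNum t + ((7 / 4) * cos t ^ 4 - 3 * cos t ^ 2 + (8 / π) * cos t ^ 3 - (4 / π) * cos t ^ 5) /
    (sin t * (3 - cos t ^ 2))

theorem hasDerivAt_etaThirdQuot {t : ℝ} (hs : sin t ≠ 0) :
    HasDerivAt etaThirdQuot (cos t ^ 4 * (π * (cos t * (9 + cos t ^ 2)) - 16 * (1 + cos t ^ 2)) /
      (4 * π * (sin t * (3 - cos t ^ 2)) ^ 2)) t := by
  have hd : 3 - cos t ^ 2 ≠ 0 := by nlinarith [cos_sq_le_one t]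
  have h := (hasDerivAt_etaNum t).add
    ((((((hasDerivAt_cos t).pow 4).const_mul (7 / 4)).sub
      (((hasDerivAt_cos t).pow 2).const_mul 3)).add
      (((hasDerivAt_cos t).pow 3).const_mul (8 / π))).sub
      (((hasDerivAt_cos t).pow 5).const_mul (4 / π)) |>.div
      ((hasDerivAt_sin t).mul (((hasDerivAt_cos t).pow 2).const_sub 3)) (mul_ne_zero hs hd))
  refine HasDerivAt.congr_deriv (f := etaThirdQuot) h ?_
  have := pi_ne_zero
  have hq := sin_sq t
  simp only [Pi.pow_apply, Pi.mul_apply, Pi.add_apply, Pi.sub_apply]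
  field_simp
  grind

theorem etaThirdQuot_pos {t : ℝ} (h0 : 0 < t) (h1 : t < π / 2) : 0 < etaThirdQuot t := by
  have hs : ∀ x ∈ Icc t (π / 2), sin x ≠ 0 := fun x hx =>
    (sin_pos_of_pos_of_lt_pi (h0.trans_le hx.1) (by linarith [hx.2, pi_pos])).ne'
  have hanti : StrictAntiOn etaThirdQuot (Icc t (π / 2)) := by
    refine strictAntiOn_of_deriv_neg (convex_Icc _ _)
      (fun x hx => (hasDerivAt_etaThirdQuot (hs x hx)).continuousAt.continuousWithinAt) ?_
    intro x hx
    rw [interior_Icc] at hx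
    have hsx := hs x (Ioo_subset_Icc_self hx)
    have hc : 0 < cos x := cos_pos_of_mem_Ioo ⟨by linarith [hx.1, pi_pos], hx.2⟩
    have hd : 3 - cos x ^ 2 ≠ 0 := by nlinarith [cos_sq_le_one x]
    rw [(hasDerivAt_etaThirdQuot hsx).deriv]
    refine div_neg_of_neg_of_pos (mul_neg_of_pos_of_neg (by positivity) ?_) ?_
    · linarith [pi_mul_cubic_lt hc (cos_le_one x)]
    · have := pi_pos
      positivity
  have h := hanti (left_mem_Icc.2 h1.le) (right_mem_Icc.2 h1.le) h1
  simpa [etaThirdQuot, etaNum_pi_div_two] using h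

theorem deriv_etaSecond_pos_of_nonneg {t : ℝ} (h0 : 0 ≤ t) (h1 : t < π / 2) :
    0 < deriv etaSecond t := by
  have hc : 0 < cos t := cos_pos_of_mem_Ioo ⟨by linarith [pi_pos], h1⟩
  rw [(hasDerivAt_etaSecond hc.ne').deriv]
  refine div_pos ?_ (by positivity)
  have hp := pi_pos
  rcases h0.eq_or_lt with rfl | h0
  · have : (10 : ℝ) < 32 / π := by
      rw [lt_div_iff₀ hp]
      linarith [pi_lt_d2]
    norm_num
    linarith
  · have hs : 0 < sin t := sin_pos_of_pos_of_lt_pi h0 (by linarith)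
    have hd : 0 < 3 - cos t ^ 2 := by nlinarith [cos_sq_le_one t]
    have h := mul_pos (mul_pos (mul_pos (by norm_num : (0 : ℝ) < 8) hs) hd)
      (etaThirdQuot_pos h0 h1)
    refine h.trans_eq ?_
    simp only [etaThirdQuot]
    field_simp
    ring

theorem deriv_etaSecond_pos {t : ℝ} (ht : t ∈ Ioo (-(π / 2)) (π / 2)) :
    0 < deriv etaSecond t := by
  rcases le_total 0 t with h | h
  · exact deriv_etaSecond_pos_of_nonneg h ht.2
  · have hn := deriv_etaSecond_pos_of_nonneg (neg_nonneg.2 h) (by linarith [ht.1])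
    have he : etaSecond = fun x => -etaSecond (-x) := by
      funext x
      rw [etaSecond_neg, neg_neg]
    rw [he, deriv.fun_neg, deriv_comp_neg, neg_neg]
    exact hn

theorem strictMonoOn_etaSecond : StrictMonoOn etaSecond (Ioo (-(π / 2)) (π / 2)) := by
  refine strictMonoOn_of_deriv_pos (convex_Ioo _ _) (fun x hx =>
    (hasDerivAt_etaSecond (cos_pos_of_mem_Ioo hx).ne').continuousAt.continuousWithinAt) ?_
  intro x hx
  rw [interior_Ioo] at hx
  exact deriv_etaSecond_pos hx

/-- The quotient of the numerator of `etaSecond` by its coefficient of `etaNum`. -/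
noncomputable def etaSecondQuot (t : ℝ) : ℝ :=
  etaNum t + (-6 * sin t * cos t ^ 2 + (16 / π) * sin t * cos t ^ 3) / (6 - 4 * cos t ^ 2)

theorem hasDerivAt_etaSecondQuot (t : ℝ) :
    HasDerivAt etaSecondQuot
      (cos t ^ 3 * (64 / π * cos t - 12 - 8 * cos t ^ 2) / (6 - 4 * cos t ^ 2) ^ 2) t := by
  have hd : 6 - 4 * cos t ^ 2 ≠ 0 := by nlinarith [cos_sq_le_one t]
  have h := (hasDerivAt_etaNum t).add
    (((((hasDerivAt_sin t).const_mul (-6)).mul ((hasDerivAt_cos t).pow 2)).add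
      (((hasDerivAt_sin t).const_mul (16 / π)).mul ((hasDerivAt_cos t).pow 3))).div
      ((((hasDerivAt_cos t).pow 2).const_mul 4).const_sub 6) hd)
  refine HasDerivAt.congr_deriv (f := etaSecondQuot) h ?_
  have := pi_ne_zero
  have hq := sin_sq t
  simp only [Pi.pow_apply, Pi.mul_apply, Pi.add_apply]
  field_simp
  grind

theorem tendsto_etaSecondQuot_div_cos :
    Tendsto (fun t => etaSecondQuot t / cos t ^ 4) (𝓝[<] (π / 2)) (𝓝 (1 / 12)) := by
  have hev : ∀ᶠ x in 𝓝[<] (π / 2), 0 < x ∧ x < π / 2 :=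
    Ioo_mem_nhdsLT (by linarith [pi_pos])
  have hlim : Tendsto (fun t => (64 / π * cos t - 12 - 8 * cos t ^ 2) /
      (-4 * sin t * (6 - 4 * cos t ^ 2) ^ 2)) (𝓝[<] (π / 2)) (𝓝 (1 / 12)) := by
    have hcont : ContinuousAt (fun t => (64 / π * cos t - 12 - 8 * cos t ^ 2) /
        (-4 * sin t * (6 - 4 * cos t ^ 2) ^ 2)) (π / 2) :=
      ContinuousAt.div (by fun_prop) (by fun_prop) (by norm_num)
    have h := hcont.tendsto.mono_left (nhdsWithin_le_nhds (s := Iio (π / 2)))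
    convert h using 2
    norm_num
  refine HasDerivAt.lhopital_zero_nhdsLT
    (f' := fun t => cos t ^ 3 * (64 / π * cos t - 12 - 8 * cos t ^ 2) / (6 - 4 * cos t ^ 2) ^ 2)
    (g' := fun t => 4 * cos t ^ 3 * -sin t)
    (Eventually.of_forall hasDerivAt_etaSecondQuot) (Eventually.of_forall fun t => ?_) ?_ ?_ ?_ ?_
  · exact_mod_cast (hasDerivAt_cos t).pow 4
  · filter_upwards [hev] with x hx
    have hc : 0 < cos x := cos_pos_of_mem_Ioo ⟨by linarith [hx.1, pi_pos], hx.2⟩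
    have hs : 0 < sin x := sin_pos_of_pos_of_lt_pi hx.1 (by linarith [hx.2, pi_pos])
    exact mul_ne_zero (by positivity) (neg_ne_zero.2 hs.ne')
  · have h := (hasDerivAt_etaSecondQuot (π / 2)).continuousAt.tendsto.mono_left
      (nhdsWithin_le_nhds (s := Iio (π / 2)))
    simpa [etaSecondQuot, etaNum_pi_div_two] using h
  · have h := (continuous_cos.pow 4).continuousAt.tendsto.mono_left
      (nhdsWithin_le_nhds (a := π / 2) (s := Iio (π / 2)))
    simpa [Pi.pow_def] using h
  · refine hlim.congr' ?_
    filter_upwards [hev] with x hx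
    have hc : cos x ≠ 0 := (cos_pos_of_mem_Ioo ⟨by linarith [hx.1, pi_pos], hx.2⟩).ne'
    have hs : sin x ≠ 0 := (sin_pos_of_pos_of_lt_pi hx.1 (by linarith [hx.2, pi_pos])).ne'
    have hd : 6 - 4 * cos x ^ 2 ≠ 0 := by nlinarith [cos_sq_le_one x]
    have := pi_ne_zero
    field_simp

theorem tendsto_etaSecond_pi_div_two : Tendsto etaSecond (𝓝[<] (π / 2)) (𝓝 (1 / 2)) := by
  have h6 : Tendsto (fun t => 6 - 4 * cos t ^ 2) (𝓝[<] (π / 2)) (𝓝 6) := by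
    have hcont : Continuous fun t => 6 - 4 * cos t ^ 2 := by fun_prop
    have h := hcont.continuousAt.tendsto.mono_left
      (nhdsWithin_le_nhds (a := π / 2) (s := Iio (π / 2)))
    simpa using h
  have h := h6.mul tendsto_etaSecondQuot_div_cos
  norm_num at h
  norm_num
  refine h.congr fun t => ?_
  have hd : 6 - 4 * cos t ^ 2 ≠ 0 := by nlinarith [cos_sq_le_one t]
  simp only [etaSecondQuot, etaSecond]
  rw [← mul_div_assoc, mul_add, mul_div_cancel₀ _ hd, add_comm]

theorem tendsto_etaSecond_neg_pi_div_two :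
    Tendsto etaSecond (𝓝[>] (-(π / 2))) (𝓝 (-(1 / 2))) := by
  have h := (tendsto_etaSecond_pi_div_two.comp (tendsto_neg_nhdsGT_neg (a := π / 2))).neg
  refine h.congr fun t => ?_
  simp [etaSecond_neg]

theorem eta_second_deriv_bounds :
    (∀ t ∈ Set.Ioo (-(Real.pi / 2)) (Real.pi / 2),
      -(1 / 2) ≤ deriv (deriv eta) t ∧ deriv (deriv eta) t ≤ 1 / 2) ∧
    Filter.Tendsto (deriv (deriv eta)) (nhdsWithin (-(Real.pi / 2)) (Set.Ioi (-(Real.pi / 2))))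
      (nhds (-(1 / 2))) ∧
    Filter.Tendsto (deriv (deriv eta)) (nhdsWithin (Real.pi / 2) (Set.Iio (Real.pi / 2)))
      (nhds (1 / 2)) ∧
    StrictMonoOn (deriv (deriv eta)) (Set.Ioo (-(Real.pi / 2)) (Real.pi / 2)) := by
  have heq : EqOn etaSecond (deriv (deriv eta)) (Ioo (-(π / 2)) (π / 2)) := fun t ht =>
    (hasDerivAt_deriv_eta (cos_pos_of_mem_Ioo ht).ne').deriv.symm
  have hpi : -(π / 2) < π / 2 := by linarith [pi_pos]
  refine ⟨fun t ht => ?_, ?_, ?_, strictMonoOn_etaSecond.congr heq⟩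
  · rw [← heq ht]
    constructor
    · refine le_of_tendsto tendsto_etaSecond_neg_pi_div_two ?_
      filter_upwards [Ioo_mem_nhdsGT ht.1] with x hx
      exact (strictMonoOn_etaSecond ⟨hx.1, hx.2.trans ht.2⟩ ht hx.2).le
    · refine ge_of_tendsto tendsto_etaSecond_pi_div_two ?_
      filter_upwards [Ioo_mem_nhdsLT ht.2] with x hx
      exact (strictMonoOn_etaSecond ht ⟨ht.1.trans hx.1, hx.2⟩ hx.1).le
  · exact tendsto_etaSecond_neg_pi_div_two.congr' (heq.eventuallyEq_of_mem (Ioo_mem_nhdsGT hpi))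
  · exact tendsto_etaSecond_pi_div_two.congr' (heq.eventuallyEq_of_mem (Ioo_mem_nhdsLT hpi))
end

section
/- The third derivative of η is strictly positive on (−π/2, π/2): η'''(t) > 0 for all t in (−π/2, π/2); moreover η'''(t) tends to 32/(15π) as t tends to either endpoint ±π/2. -/
open Real Set Filter Topology

noncomputable def etaNumerator (t : ℝ) : ℝ :=
  (4 / Real.pi) * t + (4 / Real.pi) * Real.cos t * Real.sin t - 2 * Real.sin t

noncomputable def etaThirdWeight (t : ℝ) : ℝ :=
  8 * Real.sin t * (3 - Real.cos t ^ 2)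

noncomputable def etaThirdRemainder (t : ℝ) : ℝ :=
  (4 / Real.pi) * (16 * Real.cos t ^ 3 - 8 * Real.cos t ^ 5)
    - 24 * Real.cos t ^ 2 + 14 * Real.cos t ^ 4

/-- The third derivative of `eta`, in closed form. -/
noncomputable def etaThird (t : ℝ) : ℝ :=
  (etaNumerator t * etaThirdWeight t + etaThirdRemainder t) / Real.cos t ^ 5

/-- The quotient of `etaThird t * cos t ^ 5` by `etaThirdWeight t`, whose derivative no longer
involves `t` outside of trigonometric functions. -/
noncomputable def etaThirdReduced (t : ℝ) : ℝ :=
  etaNumerator t + etaThirdRemainder t / etaThirdWeight t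

lemma hasDerivAt_etaNumerator (t : ℝ) :
    HasDerivAt etaNumerator
      (2 * (4 / Real.pi) * Real.cos t ^ 2 - 2 * Real.cos t) t := by
  have h := ((((hasDerivAt_id t).const_mul (4 / Real.pi)).add
    (((hasDerivAt_cos t).const_mul (4 / Real.pi)).mul (hasDerivAt_sin t))).sub
    ((hasDerivAt_sin t).const_mul 2))
  refine h.congr_deriv ?_
  linear_combination (-(4 / Real.pi)) * Real.sin_sq_add_cos_sq t

lemma hasDerivAt_eta_s15 {t : ℝ} (ht : Real.cos t ≠ 0) :
    HasDerivAt eta (etaNumerator t * (2 * Real.sin t) / Real.cos t ^ 3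
      + 2 * (4 / Real.pi) - 2 / Real.cos t) t := by
  have h := (hasDerivAt_etaNumerator t).div ((hasDerivAt_cos t).pow 2) (pow_ne_zero 2 ht)
  refine h.congr_deriv ?_
  simp only [Pi.pow_apply]
  field_simp
  ring

lemma hasDerivAt_eta_first {t : ℝ} (ht : Real.cos t ≠ 0) :
    HasDerivAt (fun t ↦ etaNumerator t * (2 * Real.sin t) / Real.cos t ^ 3
      + 2 * (4 / Real.pi) - 2 / Real.cos t)
      (etaNumerator t * (6 - 4 * Real.cos t ^ 2) / Real.cos t ^ 4
        + 4 * (4 / Real.pi) * Real.sin t / Real.cos t - 6 * Real.sin t / Real.cos t ^ 2) t := by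
  have h := ((((hasDerivAt_etaNumerator t).mul ((hasDerivAt_sin t).const_mul 2)).div
    ((hasDerivAt_cos t).pow 3) (pow_ne_zero 3 ht)).add_const (2 * (4 / Real.pi))).sub
    ((hasDerivAt_const t (2 : ℝ)).div (hasDerivAt_cos t) ht)
  refine h.congr_deriv ?_
  simp only [Pi.pow_apply, Pi.mul_apply]
  field_simp
  simp only [Real.sin_sq]
  ring

lemma hasDerivAt_eta_second {t : ℝ} (ht : Real.cos t ≠ 0) :
    HasDerivAt (fun t ↦ etaNumerator t * (6 - 4 * Real.cos t ^ 2) / Real.cos t ^ 4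
        + 4 * (4 / Real.pi) * Real.sin t / Real.cos t - 6 * Real.sin t / Real.cos t ^ 2)
      (etaThird t) t := by
  have h := ((((hasDerivAt_etaNumerator t).mul
    ((((hasDerivAt_cos t).pow 2).const_mul 4).const_sub 6)).div
    ((hasDerivAt_cos t).pow 4) (pow_ne_zero 4 ht)).add
    (((hasDerivAt_sin t).const_mul (4 * (4 / Real.pi))).div (hasDerivAt_cos t) ht)).sub
    (((hasDerivAt_sin t).const_mul 6).div ((hasDerivAt_cos t).pow 2) (pow_ne_zero 2 ht))
  refine h.congr_deriv ?_
  simp only [Pi.pow_apply, Pi.mul_apply, etaThird, etaThirdWeight, etaThirdRemainder]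
  field_simp
  simp only [Real.sin_sq]
  ring

lemma deriv_deriv_deriv_eta {t : ℝ} (ht : Real.cos t ≠ 0) :
    deriv (deriv (deriv eta)) t = etaThird t := by
  have hne : ∀ {s : ℝ}, Real.cos s ≠ 0 → ∀ᶠ u in 𝓝 s, Real.cos u ≠ 0 := fun hs ↦
    Real.continuous_cos.continuousAt.eventually_ne hs
  have h2 : ∀ {s : ℝ}, Real.cos s ≠ 0 → deriv (deriv eta) s =
      etaNumerator s * (6 - 4 * Real.cos s ^ 2) / Real.cos s ^ 4
        + 4 * (4 / Real.pi) * Real.sin s / Real.cos s - 6 * Real.sin s / Real.cos s ^ 2 :=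
    fun hs ↦ ((hasDerivAt_eta_first hs).congr_of_eventuallyEq
      ((hne hs).mono fun _ hu ↦ (hasDerivAt_eta_s15 hu).deriv)).deriv
  exact ((hasDerivAt_eta_second ht).congr_of_eventuallyEq
    ((hne ht).mono fun _ hu ↦ h2 hu)).deriv

lemma etaThirdWeight_pos {t : ℝ} (ht : 0 < Real.sin t) : 0 < etaThirdWeight t := by
  have := Real.cos_sq_le_one t
  exact mul_pos (by positivity) (by linarith)

lemma etaThird_eq {t : ℝ} (ht : 0 < Real.sin t) :
    etaThird t = etaThirdWeight t * (etaThirdReduced t / Real.cos t ^ 5) := by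
  have := (etaThirdWeight_pos ht).ne'
  rw [etaThird, etaThirdReduced]
  field_simp

lemma etaThird_neg (t : ℝ) : etaThird (-t) = etaThird t := by
  simp only [etaThird, etaNumerator, etaThirdWeight, etaThirdRemainder, Real.cos_neg, Real.sin_neg]
  ring

lemma hasDerivAt_etaThirdReduced {t : ℝ} (ht : 0 < Real.sin t) :
    HasDerivAt etaThirdReduced
      (Real.cos t ^ 4 * (8 * (18 * Real.cos t + 2 * Real.cos t ^ 3
        - 8 * (4 / Real.pi) * (1 + Real.cos t ^ 2)) / etaThirdWeight t ^ 2)) t := by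
  have hD := (etaThirdWeight_pos ht).ne'
  have hc := hasDerivAt_cos t
  have hM : HasDerivAt etaThirdRemainder _ t :=
    (((((hc.pow 3).const_mul 16).sub ((hc.pow 5).const_mul 8)).const_mul (4 / Real.pi)).sub
      ((hc.pow 2).const_mul 24)).add ((hc.pow 4).const_mul 14)
  have hW : HasDerivAt etaThirdWeight _ t :=
    ((hasDerivAt_sin t).const_mul 8).mul ((hc.pow 2).const_sub 3)
  refine ((hasDerivAt_etaNumerator t).add (hM.div hW hD)).congr_deriv ?_
  rw [← mul_div_assoc (Real.cos t ^ 4), eq_div_iff (pow_ne_zero 2 hD), add_mul,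
    div_mul_cancel₀ _ (pow_ne_zero 2 hD)]
  simp only [etaThirdWeight, etaThirdRemainder]
  ring_nf
  simp only [Real.sin_sq]
  ring

lemma cubic_lt_of_le_one {x : ℝ} (hx : x ≤ 1) :
    18 * x + 2 * x ^ 3 - 8 * (4 / Real.pi) * (1 + x ^ 2) < 0 := by
  have hp : (5 / 4 : ℝ) < 4 / Real.pi := by
    rw [lt_div_iff₀ Real.pi_pos]
    linarith [Real.pi_lt_d2]
  nlinarith [mul_pos (sub_pos.2 hp) (by positivity : 0 < 1 + x ^ 2),
    mul_nonneg (sub_nonneg.2 hx) (sq_nonneg (x - 1)), mul_nonneg (sub_nonneg.2 hx) (sq_nonneg x)]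

lemma etaThirdReduced_pi_div_two : etaThirdReduced (Real.pi / 2) = 0 := by
  have := Real.pi_ne_zero
  simp only [etaThirdReduced, etaNumerator, etaThirdRemainder, Real.cos_pi_div_two,
    Real.sin_pi_div_two]
  field_simp
  ring

lemma etaThirdReduced_pos {t : ℝ} (ht : t ∈ Set.Ioo 0 (Real.pi / 2)) : 0 < etaThirdReduced t := by
  have hsin : ∀ {s : ℝ}, s ∈ Set.Ioc 0 (Real.pi / 2) → 0 < Real.sin s := fun hs ↦
    Real.sin_pos_of_pos_of_lt_pi hs.1 (by linarith [hs.2, Real.pi_pos])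
  have hanti : StrictAntiOn etaThirdReduced (Set.Ioc 0 (Real.pi / 2)) := by
    refine strictAntiOn_of_deriv_neg (convex_Ioc _ _)
      (fun s hs ↦ (hasDerivAt_etaThirdReduced (hsin hs)).continuousAt.continuousWithinAt) ?_
    intro s hs
    rw [interior_Ioc] at hs
    have hs' := hsin (Set.Ioo_subset_Ioc_self hs)
    have hcos : 0 < Real.cos s :=
      Real.cos_pos_of_mem_Ioo ⟨by linarith [hs.1, Real.pi_pos], hs.2⟩
    rw [(hasDerivAt_etaThirdReduced hs').deriv]
    exact mul_neg_of_pos_of_neg (by positivity) (div_neg_of_neg_of_pos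
      (mul_neg_of_pos_of_neg (by norm_num) (cubic_lt_of_le_one (Real.cos_le_one s)))
      (pow_pos (etaThirdWeight_pos hs') 2))
  rw [← etaThirdReduced_pi_div_two]
  exact hanti ⟨ht.1, ht.2.le⟩ ⟨by linarith [Real.pi_pos], le_rfl⟩ ht.2

lemma etaThird_pos {t : ℝ} (ht : t ∈ Set.Ioo (-(Real.pi / 2)) (Real.pi / 2)) :
    0 < etaThird t := by
  have hpos : ∀ {s : ℝ}, s ∈ Set.Ioo 0 (Real.pi / 2) → 0 < etaThird s := by
    intro s hs
    have hsin := Real.sin_pos_of_pos_of_lt_pi hs.1 (by linarith [hs.2, Real.pi_pos])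
    have hcos : 0 < Real.cos s :=
      Real.cos_pos_of_mem_Ioo ⟨by linarith [hs.1, Real.pi_pos], hs.2⟩
    rw [etaThird_eq hsin]
    exact mul_pos (etaThirdWeight_pos hsin) (div_pos (etaThirdReduced_pos hs) (by positivity))
  rcases lt_trichotomy t 0 with h | rfl | h
  · rw [← etaThird_neg]
    exact hpos ⟨by linarith, by linarith [ht.1]⟩
  · have hp : (5 / 4 : ℝ) < 4 / Real.pi := by
      rw [lt_div_iff₀ Real.pi_pos]
      linarith [Real.pi_lt_d2]
    simp only [etaThird, etaNumerator, etaThirdWeight, etaThirdRemainder, Real.cos_zero,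
      Real.sin_zero]
    linarith
  · exact hpos ⟨h, ht.2⟩

lemma tendsto_etaThird_pi_div_two :
    Tendsto etaThird (𝓝[<] (Real.pi / 2)) (𝓝 (32 / (15 * Real.pi))) := by
  have hpi := Real.pi_pos
  have hlt : (0 : ℝ) < Real.pi / 2 := by positivity
  have hsin : ∀ s ∈ Set.Ioo 0 (Real.pi / 2), 0 < Real.sin s := fun s hs ↦
    Real.sin_pos_of_pos_of_lt_pi hs.1 (by linarith [hs.2])
  have hcos : ∀ s ∈ Set.Ioo 0 (Real.pi / 2), 0 < Real.cos s := fun s hs ↦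
    Real.cos_pos_of_mem_Ioo ⟨by linarith [hs.1], hs.2⟩
  have hW : etaThirdWeight (Real.pi / 2) = 24 := by
    simp [etaThirdWeight]
    norm_num
  have hWc : Continuous etaThirdWeight := by
    unfold etaThirdWeight
    fun_prop
  have hmem : ∀ᶠ s in 𝓝[<] (Real.pi / 2), s ∈ Set.Ioo 0 (Real.pi / 2) := Ioo_mem_nhdsLT hlt
  have hratio : Tendsto (fun s ↦ (8 * (18 * Real.cos s + 2 * Real.cos s ^ 3
        - 8 * (4 / Real.pi) * (1 + Real.cos s ^ 2)) / etaThirdWeight s ^ 2) / (-5 * Real.sin s))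
      (𝓝[<] (Real.pi / 2)) (𝓝 (4 / (45 * Real.pi))) := by
    have hcont : ContinuousAt (fun s ↦ (8 * (18 * Real.cos s + 2 * Real.cos s ^ 3
        - 8 * (4 / Real.pi) * (1 + Real.cos s ^ 2)) / etaThirdWeight s ^ 2) / (-5 * Real.sin s))
        (Real.pi / 2) := by
      refine ContinuousAt.div (ContinuousAt.div (by fun_prop) (by fun_prop) ?_) (by fun_prop) ?_
      · rw [hW]
        norm_num
      · simp
    convert hcont.tendsto.mono_left nhdsWithin_le_nhds using 2
    simp only [hW, Real.cos_pi_div_two, Real.sin_pi_div_two]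
    field_simp
    norm_num
  have hquot : Tendsto (fun s ↦ etaThirdReduced s / Real.cos s ^ 5) (𝓝[<] (Real.pi / 2))
      (𝓝 (4 / (45 * Real.pi))) := by
    refine HasDerivAt.lhopital_zero_left_on_Ioo hlt
      (fun s hs ↦ hasDerivAt_etaThirdReduced (hsin s hs))
      (fun s _ ↦ (hasDerivAt_cos s).pow 5) ?_ ?_ ?_ ?_
    · intro s hs
      have := hsin s hs
      have := hcos s hs
      simp
      grind
    · have h := (hasDerivAt_etaThirdReduced (t := Real.pi / 2) (by simp)).continuousAt.tendsto
      rw [etaThirdReduced_pi_div_two] at h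
      exact h.mono_left nhdsWithin_le_nhds
    · have h : Tendsto (fun s ↦ Real.cos s ^ 5) (𝓝 (Real.pi / 2)) (𝓝 0) :=
        Continuous.tendsto' (by fun_prop) _ _ (by simp)
      exact h.mono_left nhdsWithin_le_nhds
    · refine hratio.congr' ?_
      filter_upwards [hmem] with s hs
      have := (hsin s hs).ne'
      have := (hcos s hs).ne'
      have := (etaThirdWeight_pos (hsin s hs)).ne'
      push_cast
      field_simp
  have h := ((hWc.tendsto (Real.pi / 2)).mono_left nhdsWithin_le_nhds).mul hquot
  rw [hW, show 24 * (4 / (45 * Real.pi)) = 32 / (15 * Real.pi) by field_simp; norm_num] at h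
  refine h.congr' ?_
  filter_upwards [hmem] with s hs
  exact (etaThird_eq (hsin s hs)).symm

theorem eta_third_deriv_pos :
    (∀ t ∈ Set.Ioo (-(Real.pi / 2)) (Real.pi / 2), 0 < deriv (deriv (deriv eta)) t) ∧
    Filter.Tendsto (deriv (deriv (deriv eta)))
      (nhdsWithin (Real.pi / 2) (Set.Iio (Real.pi / 2))) (nhds (32 / (15 * Real.pi))) ∧
    Filter.Tendsto (deriv (deriv (deriv eta)))
      (nhdsWithin (-(Real.pi / 2)) (Set.Ioi (-(Real.pi / 2)))) (nhds (32 / (15 * Real.pi))) := by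
  have hderiv : ∀ t ∈ Set.Ioo (-(Real.pi / 2)) (Real.pi / 2),
      etaThird t = deriv (deriv (deriv eta)) t := fun t ht ↦
    (deriv_deriv_deriv_eta (Real.cos_pos_of_mem_Ioo ht).ne').symm
  have hlt : -(Real.pi / 2) < Real.pi / 2 := by linarith [Real.pi_pos]
  refine ⟨fun t ht ↦ hderiv t ht ▸ etaThird_pos ht, ?_, ?_⟩
  · exact tendsto_etaThird_pi_div_two.congr' (Filter.mem_of_superset (Ioo_mem_nhdsLT hlt) hderiv)
  · have h := tendsto_etaThird_pi_div_two.comp (tendsto_neg_nhdsGT_neg (a := Real.pi / 2))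
    refine h.congr' (Filter.mem_of_superset (Ioo_mem_nhdsGT hlt) fun t ht ↦ ?_)
    exact (etaThird_neg t).trans (hderiv t ht)
end
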